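/- There exist a constant C₃ > 0 and N ∈ ℕ such that for all n ≥ N and all integers m with n ≤ m ≤ 2n, one has |Var(𝔇_m − 𝔇_n) − (m − n)| ≤ C₃·√n·(log n)² + C₃·(m−n)²/n. -/

import Mathlib

open MeasureTheory ProbabilityTheory Filter

/-- The asymptotic condition `1/w(n) = n^α (1 + 2B/n + O(1/n²))` on the weight function. -/
def WeightAsymp (w : ℕ → ℝ) (α B : ℝ) : Prop :=
  ∃ C₀ > (0:ℝ), ∃ N₀ : ℕ, ∀ n : ℕ, N₀ ≤ n →
    |1 / w n - (n:ℝ) ^ α - 2 * B * (n:ℝ) ^ (α - 1)| ≤ C₀ * (n:ℝ) ^ (α - 2)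

/-- The three admissible choices of `(b, r)` in terms of the weight function `w`. -/
def UrnChoice (w b r : ℕ → ℝ) : Prop :=
  (∀ i, b i = w (2*i) ∧ r i = w (2*i+1)) ∨
  (∀ i, b i = w (2*i+1) ∧ r i = w (2*i)) ∨
  (∀ i, b i = w (2*i) ∧ r i = w (2*i))

/-- A generalized Pólya urn process: `Bl n` and `Re n` are the numbers of blue and red
balls drawn in the first `n` draws; started at `(0,0)`, exactly one coordinate increases
by `1` at each step, and conditionally on the past the blue coordinate increases with
probability `b(Bl n)/(b(Bl n) + r(Re n))`. -/
structure Urn {Ω : Type*} [MeasurableSpace Ω] (μ : Measure Ω) (b r : ℕ → ℝ) where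
  Bl : ℕ → Ω → ℕ
  Re : ℕ → Ω → ℕ
  meas_Bl : ∀ n, Measurable (Bl n)
  meas_Re : ∀ n, Measurable (Re n)
  init_Bl : ∀ ω, Bl 0 ω = 0
  init_Re : ∀ ω, Re 0 ω = 0
  step : ∀ n ω, (Bl (n+1) ω = Bl n ω + 1 ∧ Re (n+1) ω = Re n ω) ∨
                (Bl (n+1) ω = Bl n ω ∧ Re (n+1) ω = Re n ω + 1)
  markov : ∀ n : ℕ,
    μ[(fun ω => if Bl (n+1) ω = Bl n ω + 1 then (1:ℝ) else 0) |
        ⨆ j ∈ Set.Iic n, MeasurableSpace.comap (fun ω => (Bl j ω, Re j ω)) inferInstance]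
      =ᵐ[μ] fun ω => b (Bl n ω) / (b (Bl n ω) + r (Re n ω))

namespace Urn

variable {Ω : Type*} [MeasurableSpace Ω] {μ : Measure Ω} {b r : ℕ → ℝ}

/-- The discrepancy `𝔇_n = ℜ_n − 𝔅_n`. -/
def D (U : Urn μ b r) (n : ℕ) (ω : Ω) : ℤ := (U.Re n ω : ℤ) - (U.Bl n ω : ℤ)

/-- `τ_k^𝔅`, the number of draws until the `k`-th blue ball. -/
noncomputable def tau (U : Urn μ b r) : ℕ → Ω → ℕ
  | 0 => fun _ => 0
  | k+1 => fun ω => sInf {n : ℕ | U.tau k ω < n ∧ U.Bl n ω = U.Bl (n-1) ω + 1}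

/-- The natural filtration `ℱ_n = σ((𝔅_j, ℜ_j), j ≤ n)`. -/
def F (U : Urn μ b r) (n : ℕ) : MeasurableSpace Ω :=
  ⨆ j ∈ Set.Iic n, MeasurableSpace.comap (fun ω => (U.Bl j ω, U.Re j ω)) inferInstance

end Urn


/-- Second order Taylor bound for `(1 + u) ^ α` on `[-1/2, 1/2]`. -/
theorem abs_one_add_rpow_sub_le (α : ℝ) :
    ∃ C > (0:ℝ), ∀ u : ℝ, |u| ≤ 1/2 → |(1+u)^α - 1 - α*u| ≤ C*u^2 := by
  have hcont : ContinuousOn (fun v : ℝ => α * ((α-1) * (1+v)^(α-1-1))) (Set.Icc (-(1/2)) (1/2)) := by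
    intro v hv
    have : (1+v) ≠ 0 := by linarith [hv.1]
    exact (ContinuousAt.mul continuousAt_const (ContinuousAt.mul continuousAt_const
      (ContinuousAt.rpow_const (by fun_prop) (Or.inl this)))).continuousWithinAt
  obtain ⟨M, hM⟩ := isCompact_Icc.exists_bound_of_continuousOn hcont
  refine ⟨|M| + 1, by positivity, fun u hu => ?_⟩
  have hsub : ∀ v ∈ Set.Icc (-|u|) |u|, v ∈ Set.Icc (-(1/2):ℝ) (1/2) := fun v hv =>
    ⟨by linarith [hv.1], by linarith [hv.2]⟩
  have hd : ∀ (p : ℝ), ∀ v ∈ Set.Icc (-|u|) |u|,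
      HasDerivAt (fun v : ℝ => (1+v)^p) (p * (1+v)^(p-1)) v := by
    intro p v hv
    have h0 : (1+v) ≠ 0 := by linarith [(hsub v hv).1]
    have := ((hasDerivAt_id v).const_add 1).rpow_const (p := p) (Or.inl h0)
    simpa using this
  have h0 : (0:ℝ) ∈ Set.Icc (-|u|) |u| := by simp
  have hu' : u ∈ Set.Icc (-|u|) |u| := ⟨neg_abs_le u, le_abs_self u⟩
  have h1 : ∀ v ∈ Set.Icc (-|u|) |u|, ‖α*(1+v)^(α-1) - α‖ ≤ |M| * |u| := by
    intro v hv
    have := (convex_Icc (-|u|) |u|).norm_image_sub_le_of_norm_hasDerivWithin_le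
      (f := fun v : ℝ => α * (1+v)^(α-1)) (C := |M|)
      (fun y hy => ((hd (α-1) y hy).const_mul α).hasDerivWithinAt)
      (fun y hy => (hM y (hsub y hy)).trans (le_abs_self M)) h0 hv
    simp only [add_zero, Real.one_rpow, mul_one, sub_zero] at this
    refine this.trans ?_
    gcongr
    exact abs_le.2 hv
  have h2 := (convex_Icc (-|u|) |u|).norm_image_sub_le_of_norm_hasDerivWithin_le
      (f := fun v : ℝ => (1+v)^α - α*v) (C := |M| * |u|)
      (fun y hy => ((hd α y hy).sub ((hasDerivAt_id y).const_mul α)).hasDerivWithinAt)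
      (fun y hy => by simpa using h1 y hy) h0 hu'
  simp only [add_zero, Real.one_rpow, mul_zero, sub_zero, Real.norm_eq_abs] at h2
  have h3 : (1+u)^α - α*u - 1 = (1+u)^α - 1 - α*u := by ring
  rw [h3] at h2
  refine h2.trans ?_
  rw [mul_assoc, abs_mul_abs_self]
  nlinarith [sq_nonneg u]

/-- `f i = (i + 1) ^ α (1 + O(1 / (i + 1)))`, with explicit constant `C`. -/
def IsNearPow (f : ℕ → ℝ) (α C : ℝ) : Prop :=
  ∀ i : ℕ, |f i - ((i:ℝ)+1)^α| ≤ C * ((i:ℝ)+1)^α / ((i:ℝ)+1)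

theorem IsNearPow.mono {f : ℕ → ℝ} {α C C' : ℝ} (h : IsNearPow f α C) (hC : C ≤ C') :
    IsNearPow f α C' := fun i => (h i).trans (by gcongr)

theorem WeightAsymp.exists_isNearPow {w : ℕ → ℝ} {α B : ℝ} (h : WeightAsymp w α B) (c : ℕ)
    (hc : c ≤ 1) : ∃ C > (0:ℝ), IsNearPow (fun i => (2^α * w (2*i+c))⁻¹) α C := by
  obtain ⟨C₀, hC₀, N₀, hN⟩ := h
  obtain ⟨C₁, hC₁, hT⟩ := abs_one_add_rpow_sub_le α
  have hO : (fun i : ℕ => (2^α * w (2*i+c))⁻¹ - ((i:ℝ)+1)^α) =O[atTop]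
      (fun i : ℕ => ((i:ℝ)+1)^α / ((i:ℝ)+1)) := by
    refine Asymptotics.IsBigO.of_bound ((2*|B|+C₀)*(1+|α|+C₁)*2 + (|α|+C₁)) ?_
    filter_upwards [eventually_ge_atTop (N₀+1)] with i hi
    have hi1 : (1:ℝ) ≤ i := by exact_mod_cast (by omega : 1 ≤ i)
    set s : ℝ := (i:ℝ)+1 with hs
    have hs2 : 2 ≤ s := by linarith
    set u : ℝ := -(2-c)/(2*s) with hu
    have hc' : (c:ℝ) ≤ 1 := by exact_mod_cast hc
    have hc0 : (0:ℝ) ≤ c := by positivity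
    have hus : |u| ≤ 1/s := by
      rw [hu, abs_div, abs_neg, abs_of_nonneg (by linarith : (0:ℝ) ≤ 2-c),
        abs_of_pos (by linarith : 0 < 2*s), div_le_div_iff₀ (by linarith) (by linarith)]
      nlinarith
    have hs1 : 1/s ≤ 1/2 := one_div_le_one_div_of_le (by norm_num) hs2
    have hn : ((2*i+c : ℕ):ℝ) = 2 * s * (1+u) := by
      rw [hu]; push_cast; field_simp; rw [hs]; ring
    have hu1 : 1/2 ≤ 1+u := by linarith [(abs_le.1 (hus.trans hs1)).1]
    have hsp : 0 < s := by linarith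
    have hpw : ∀ p : ℝ, ((2*i+c : ℕ):ℝ)^p = 2^p * s^p*(1+u)^p := fun p => by
      rw [hn, Real.mul_rpow (by positivity) (by linarith), Real.mul_rpow (by positivity) hsp.le]
    have hw := hN (2*i+c) (by omega)
    have hnpos : (0:ℝ) < ((2*i+c : ℕ):ℝ) := by rw [hn]; positivity
    have hn1 : (1:ℝ) ≤ ((2*i+c : ℕ):ℝ) := by exact_mod_cast (by omega : 1 ≤ 2*i+c)
    set n : ℝ := ((2*i+c : ℕ):ℝ) with hndef
    have e1 : n^(α-1) = n^α/n := by rw [Real.rpow_sub hnpos, Real.rpow_one]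
    have e2 : n^(α-2) ≤ n^α/n := by
      rw [← e1]; exact Real.rpow_le_rpow_of_exponent_le hn1 (by linarith)
    have hb1 : |1 / w (2*i+c) - n^α| ≤ (2*|B|+C₀)*(n^α/n) := by
      have : |2*B*n^(α-1)| = 2 * |B| * (n^α/n) := by
        rw [e1, abs_mul, abs_mul, abs_of_nonneg (by positivity : 0 ≤ n^α/n)]; norm_num
      have h3 := abs_add_le (1 / w (2*i+c) - n^α - 2*B*n^(α-1)) (2*B*n^(α-1))
      rw [sub_add_cancel, this] at h3
      nlinarith [mul_le_mul_of_nonneg_left e2 hC₀.le]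
    have hT1 : |(1+u)^α - 1| ≤ (|α|+C₁)/s := by
      have h3 := abs_add_le ((1+u)^α - 1 - α*u) (α*u)
      rw [sub_add_cancel, abs_mul] at h3
      have h4 := hT u (hus.trans hs1)
      have h5 : u^2 ≤ |u| := by
        rw [← sq_abs]; nlinarith [abs_nonneg u, hus.trans hs1]
      have h6 : |(1+u)^α - 1| ≤ (|α|+C₁) * |u| := by nlinarith
      refine h6.trans ?_
      rw [div_eq_mul_one_div]; gcongr
    have hT2 : (1+u)^α ≤ 1+|α|+C₁ := by
      have := (abs_le.1 hT1).2
      have h7 : (|α|+C₁)/s ≤ |α|+C₁ := div_le_self (by positivity) (by linarith)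
      linarith
    have h2p : (0:ℝ) < 2^α := by positivity
    have hn2 : n^α / n ≤ 2^α * (s^α * (1+|α|+C₁) * 2 / s) := by
      rw [hpw, hn]
      have hd : 1/(2*s*(1+u)) ≤ 1/s :=
        one_div_le_one_div_of_le hsp (by nlinarith)
      calc 2^α*s^α*(1+u)^α/(2*s*(1+u)) = 2^α*s^α*(1+u)^α*(1/(2*s*(1+u))) := by ring
        _ ≤ 2^α*s^α*(1+|α|+C₁)*(1/s) := by gcongr
        _ ≤ 2^α*s^α*(1+|α|+C₁)*(1/s)*2 := by
            have : 0 ≤ 2^α*s^α*(1+|α|+C₁)*(1/s) := by positivity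
            linarith
        _ = _ := by ring
    have key : (2^α * w (2*i+c))⁻¹ - s^α
        = (1 / w (2*i+c) - n^α)/2^α + s^α * ((1+u)^α - 1) := by
      rw [hpw, mul_inv]; field_simp; ring
    rw [key, Real.norm_eq_abs, Real.norm_eq_abs, abs_of_nonneg (by positivity : 0 ≤ s^α/s)]
    refine (abs_add_le _ _).trans ?_
    rw [abs_div, abs_of_pos h2p, abs_mul, abs_of_nonneg (by positivity : 0 ≤ s^α)]
    have t1 : |1 / w (2*i+c) - n^α|/2^α ≤ (2*|B|+C₀)*(s^α * (1+|α|+C₁) * 2 / s) := by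
      rw [div_le_iff₀ h2p]
      refine hb1.trans ?_
      calc _ ≤ (2*|B|+C₀)*(2^α * (s^α * (1+|α|+C₁) * 2 / s)) := by gcongr
        _ = _ := by ring
    have t2 : s^α * |(1+u)^α - 1| ≤ s^α * ((|α|+C₁)/s) := by gcongr
    refine (add_le_add t1 t2).trans (le_of_eq ?_)
    ring
  obtain ⟨C, hC, hb⟩ := Asymptotics.bound_of_isBigO_nat_atTop hO
  refine ⟨C, hC, fun i => ?_⟩
  have := hb (x := i) (by positivity)
  rw [Real.norm_eq_abs, Real.norm_eq_abs, abs_of_nonneg (by positivity : 0 ≤ ((i:ℝ)+1)^α / ((i:ℝ)+1))] at this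
  rw [mul_div_assoc]; exact this

theorem UrnChoice.exists_isNearPow {w b r : ℕ → ℝ} {α B : ℝ} (h : WeightAsymp w α B)
    (hc : UrnChoice w b r) : ∃ C > (0:ℝ), IsNearPow (fun i => (2^α * b i)⁻¹) α C ∧
      IsNearPow (fun i => (2^α * r i)⁻¹) α C := by
  obtain ⟨C, hC, h0⟩ := h.exists_isNearPow 0 (by norm_num)
  obtain ⟨C', hC', h1⟩ := h.exists_isNearPow 1 (by norm_num)
  have h0 := h0.mono (le_max_left C C')
  simp only [add_zero] at h0
  have h1 := h1.mono (le_max_right C C')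
  refine ⟨max C C', lt_max_of_lt_left hC, ?_⟩
  rcases hc with hc | hc | hc
  · exact ⟨by simpa only [hc] using h0, by simpa only [hc] using h1⟩
  · exact ⟨by simpa only [hc] using h1, by simpa only [hc] using h0⟩
  · exact ⟨by simpa only [hc] using h0, by simpa only [hc] using h0⟩

/-- An index much larger than another one has the larger value. -/
theorem IsNearPow.exists_le {f g : ℕ → ℝ} {α C : ℝ} (hα : 0 < α) (hC : 0 < C)
    (hf : IsNearPow f α C) (hg : IsNearPow g α C) :
    ∃ T > (0:ℝ), ∀ i j : ℕ, 3*((i:ℝ)+1) ≤ (j:ℝ)+1 → T ≤ (j:ℝ)+1 → f i ≤ g j := by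
  set q : ℝ := (1/3)^α with hq
  have hq1 : q < 1 := Real.rpow_lt_one (by norm_num) (by norm_num) hα
  have hq0 : 0 < q := by positivity
  set ε : ℝ := (1-q)/4 with hε
  have hε0 : 0 < ε := by rw [hε]; linarith
  set M : ℝ := C*(C/ε)^α with hM
  have hM0 : 0 < M := by positivity
  have hkey : ∀ s : ℝ, 1 ≤ s → C * s^α / s ≤ ε * s^α + M := by
    intro s hs
    have hsα : 0 < s^α := by positivity
    rcases le_total (C/ε) s with h | h
    · have : C * s^α / s ≤ ε * s^α := by
        rw [div_le_iff₀ (by linarith)]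
        rw [div_le_iff₀ hε0] at h
        nlinarith
      linarith
    · have h1 : C * s^α / s ≤ C * s^α := div_le_self (by positivity) hs
      have h2 : s^α ≤ (C/ε)^α := Real.rpow_le_rpow (by linarith) h hα.le
      have h3 : C * s^α ≤ M := by rw [hM]; gcongr
      nlinarith
  obtain ⟨T, hT⟩ := eventually_atTop.1
    ((tendsto_rpow_atTop hα).eventually_ge_atTop (4*M/(1-q)))
  refine ⟨max T 1, by positivity, fun i j hij hj => ?_⟩
  set s : ℝ := (i:ℝ)+1 with hs
  set t : ℝ := (j:ℝ)+1 with ht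
  have hs1 : 1 ≤ s := by rw [hs]; linarith [Nat.cast_nonneg (α := ℝ) i]
  have ht1 : 1 ≤ t := by rw [ht]; linarith [Nat.cast_nonneg (α := ℝ) j]
  have h1 := (abs_le.1 (hf i)).2
  have h2 := (abs_le.1 (hg j)).1
  have hst : s^α ≤ q*t^α := by
    rw [hq, ← Real.mul_rpow (by norm_num) (by linarith)]
    exact Real.rpow_le_rpow (by linarith) (by linarith) hα.le
  have h3 := hT t ((le_max_left _ _).trans hj)
  rw [div_le_iff₀ (by linarith)] at h3
  have h4 := hkey s hs1
  have h5 := hkey t ht1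
  have ht0 : 0 < t^α := by positivity
  have h6 : (1+ε)*s^α ≤ (1+ε)*(q*t^α) := by gcongr
  have h7 : ε*q*t^α ≤ ε * t^α := by
    have : ε * q ≤ ε := by nlinarith
    gcongr
  have h8 : ε * t^α = t^α*(1-q)/4 := by rw [hε]; ring
  simp only [← hs, ← ht] at h1 h2
  linarith

/-- The normalized difference changes by `O(1/K)` under relative perturbations of size `O(1/K)`. -/
theorem abs_sub_div_add_sub_le {x y a c δ : ℝ} (ha : 0 < a) (hc : 0 < c) (hδ : δ ≤ 1/2)
    (hx : |x - a| ≤ δ*a) (hy : |y - c| ≤ δ*c) :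
    |(x-y)/(x+y) - (a-c)/(a+c)| ≤ 2*δ := by
  have hδ0 : 0 ≤ δ := by
    by_contra! h
    linarith [abs_nonneg (x-a), mul_neg_of_neg_of_pos h ha]
  have hx1 := abs_le.1 hx
  have hy1 := abs_le.1 hy
  have hx2 : a/2 ≤ x := by nlinarith
  have hy2 : c/2 ≤ y := by nlinarith
  have hxy : (a+c)/2 ≤ x+y := by linarith
  have h0 : 0 < x+y := by linarith
  have e : (x-y)/(x+y) - (a-c)/(a+c) = 2*(c*(x-a)-a*(y-c))/((x+y)*(a+c)) := by
    field_simp; ring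
  rw [e, abs_div, abs_of_pos (by positivity : 0 < (x+y)*(a+c)), div_le_iff₀ (by positivity)]
  have h1 : |c*(x-a)-a*(y-c)| ≤ 2*δ*(a*c) := by
    rw [abs_le]; constructor <;> nlinarith
  rw [abs_mul, abs_two]
  have h2 : (a+c)/2*(a+c) ≤ (x+y)*(a+c) := by gcongr
  nlinarith [sq_nonneg (a-c), mul_le_mul_of_nonneg_left h2 hδ0, mul_nonneg hδ0 (sq_nonneg (a-c))]

theorem abs_sub_div_add_le_one {x y : ℝ} (hx : 0 < x) (hy : 0 < y) : |(x-y)/(x+y)| ≤ 1 := by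
  rw [abs_div, abs_of_pos (by positivity : 0 < x+y), div_le_one (by positivity), abs_le]
  constructor <;> linarith

theorem IsNearPow.exists_abs_sub_le {f g : ℕ → ℝ} {α C : ℝ} (hC : 0 < C)
    (hf0 : ∀ i, 0 < f i) (hg0 : ∀ i, 0 < g i)
    (hf : IsNearPow f α C) (hg : IsNearPow g α C) :
    ∃ C' > (0:ℝ), ∀ i j : ℕ, |(j:ℝ)-i| ≤ ((i:ℝ)+j+2)/2 →
      |(f i - g j)/(f i + g j) -
        (((i:ℝ)+1)^α - ((j:ℝ)+1)^α)/(((i:ℝ)+1)^α + ((j:ℝ)+1)^α)| ≤ C'/((i:ℝ)+j+2) := by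
  refine ⟨16*C, by positivity, fun i j hij => ?_⟩
  set K : ℝ := (i:ℝ)+j+2 with hK
  have hK0 : 0 < K := by positivity
  have hij' := abs_le.1 hij
  rcases le_total K (8*C) with h | h
  · have h1 := abs_sub_div_add_le_one (hf0 i) (hg0 j)
    have h2 := abs_sub_div_add_le_one (x := ((i:ℝ)+1)^α) (y := ((j:ℝ)+1)^α)
      (by positivity) (by positivity)
    refine (abs_sub _ _).trans ?_
    rw [le_div_iff₀ hK0]
    nlinarith
  · have hδ : 4*C/K ≤ 1/2 := by rw [div_le_iff₀ hK0]; linarith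
    have hdiv : ∀ s : ℝ, K/4 ≤ s → C*s^α/s ≤ 4*C/K*s^α := by
      intro s hs
      have hs0 : 0 < s := by linarith
      have hsα : 0 < s^α := by positivity
      rw [div_le_iff₀ hs0]
      have : 1 ≤ 4/K*s := by
        rw [div_mul_eq_mul_div, le_div_iff₀ hK0]; linarith
      calc C*s^α = C*s^α*1 := by ring
        _ ≤ C*s^α*(4/K*s) := by gcongr
        _ = _ := by ring
    refine (abs_sub_div_add_sub_le (by positivity) (by positivity) hδ
      ((hf i).trans (hdiv _ (by linarith))) ((hg j).trans (hdiv _ (by linarith)))).trans ?_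
    rw [← mul_div_assoc]
    exact div_le_div_of_nonneg_right (by linarith) hK0.le

/-- The drift pushes the discrepancy back, up to a bounded contribution. -/
theorem IsNearPow.exists_mul_le {f g : ℕ → ℝ} {α C : ℝ} (hα : 0 < α) (hC : 0 < C)
    (hf0 : ∀ i, 0 < f i) (hg0 : ∀ i, 0 < g i)
    (hf : IsNearPow f α C) (hg : IsNearPow g α C) :
    ∃ C' > (0:ℝ), ∀ i j : ℕ, ((j:ℝ)-i) * ((f i - g j)/(f i + g j)) ≤ C' := by
  obtain ⟨T, hT0, hT⟩ := hf.exists_le hα hC hg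
  obtain ⟨T', hT'0, hT'⟩ := hg.exists_le hα hC hf
  obtain ⟨C', hC', h⟩ := hf.exists_abs_sub_le hC hf0 hg0 hg
  refine ⟨C'+T+T', by positivity, fun i j => ?_⟩
  set G : ℝ := (f i - g j)/(f i + g j) with hG
  have hG1 := abs_le.1 (abs_sub_div_add_le_one (hf0 i) (hg0 j))
  have hfg : 0 < f i + g j := add_pos (hf0 i) (hg0 j)
  rw [← hG] at hG1
  rcases le_or_gt |(j:ℝ)-i| (((i:ℝ)+j+2)/2) with hn | hn
  · have h1 := h i j hn
    set K : ℝ := (i:ℝ)+j+2 with hK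
    have hK0 : 0 < K := by positivity
    set H : ℝ := (((i:ℝ)+1)^α - ((j:ℝ)+1)^α)/(((i:ℝ)+1)^α + ((j:ℝ)+1)^α) with hH
    have hxH : ((j:ℝ)-i) * H ≤ 0 := by
      rcases le_total (j:ℝ) i with hji | hji
      · have : ((j:ℝ)+1)^α ≤ ((i:ℝ)+1)^α :=
          Real.rpow_le_rpow (by positivity) (by linarith) hα.le
        exact mul_nonpos_of_nonpos_of_nonneg (by linarith)
          (div_nonneg (by linarith) (by positivity))
      · have : ((i:ℝ)+1)^α ≤ ((j:ℝ)+1)^α :=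
          Real.rpow_le_rpow (by positivity) (by linarith) hα.le
        exact mul_nonpos_of_nonneg_of_nonpos (by linarith)
          (div_nonpos_of_nonpos_of_nonneg (by linarith) (by positivity))
    have h2 : ((j:ℝ)-i) * (G - H) ≤ C' := by
      refine (le_abs_self _).trans ?_
      rw [abs_mul]
      calc _ ≤ K/2 * (C'/K) := by gcongr
        _ = C'/2 := by field_simp
        _ ≤ C' := by linarith
    nlinarith
  · have hi0 : (0:ℝ) ≤ i := by positivity
    have hj0 : (0:ℝ) ≤ j := by positivity
    rcases lt_abs.1 hn with hn | hn
    · rcases le_or_gt T ((j:ℝ)+1) with hjT | hjT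
      · have h1 := hT i j (by linarith) hjT
        have : G ≤ 0 := div_nonpos_of_nonpos_of_nonneg (by linarith) hfg.le
        nlinarith
      · nlinarith
    · rcases le_or_gt T' ((i:ℝ)+1) with hjT | hjT
      · have h1 := hT' j i (by linarith) hjT
        have : 0 ≤ G := div_nonneg (by linarith) hfg.le
        nlinarith
      · nlinarith

/-- The drift is linear in the discrepancy up to quadratic errors. -/
theorem IsNearPow.exists_abs_add_le {f g : ℕ → ℝ} {α C : ℝ} (hα : 0 < α) (hC : 0 < C)
    (hf0 : ∀ i, 0 < f i) (hg0 : ∀ i, 0 < g i)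
    (hf : IsNearPow f α C) (hg : IsNearPow g α C) :
    ∃ C' > (0:ℝ), ∀ i j : ℕ,
      |(f i - g j)/(f i + g j) + α * ((j:ℝ)-i)/((i:ℝ)+j+2)|
        ≤ C' * (1/((i:ℝ)+j+2) + ((j:ℝ)-i)^2/((i:ℝ)+j+2)^2) := by
  obtain ⟨C₁, hC₁, hT⟩ := abs_one_add_rpow_sub_le α
  obtain ⟨C', hC', h⟩ := hf.exists_abs_sub_le hC hf0 hg0 hg
  refine ⟨C' + 4*(1+α) + 2*(1+α)*C₁, by positivity, fun i j => ?_⟩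
  set G : ℝ := (f i - g j)/(f i + g j) with hG
  have hG1 := abs_sub_div_add_le_one (hf0 i) (hg0 j)
  rw [← hG] at hG1
  have hgen := h i j
  have hxK : |(j:ℝ)-i| ≤ (i:ℝ)+j+2 := by
    rw [abs_le]; constructor <;> linarith [Nat.cast_nonneg (α := ℝ) i, Nat.cast_nonneg (α := ℝ) j]
  have hKs : (i:ℝ)+1 = ((i:ℝ)+j+2)/2*(1+-(((j:ℝ)-i)/((i:ℝ)+j+2))) := by field_simp; ring
  have hKt : (j:ℝ)+1 = ((i:ℝ)+j+2)/2*(1+((j:ℝ)-i)/((i:ℝ)+j+2)) := by field_simp; ring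
  rw [hKs, hKt, ← hG] at hgen
  have hK0 : 0 < (i:ℝ)+j+2 := by positivity
  rw [← div_pow, mul_div_assoc]
  set K : ℝ := (i:ℝ)+j+2 with hK
  set u : ℝ := ((j:ℝ)-i)/K with hu
  have habs : |u| = |(j:ℝ)-i|/K := by rw [hu, abs_div, abs_of_pos hK0]
  have hK1 : 0 ≤ 1/K := by positivity
  have hu1 : |u| ≤ 1 := by rw [habs, div_le_one hK0]; exact hxK
  rcases le_or_gt |(j:ℝ)-i| (K/2) with hn | hn
  · have h1 := hgen hn
    have hu2 : |u| ≤ 1/2 := by rw [habs, div_le_iff₀ hK0]; linarith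
    have hu3 := abs_le.1 hu2
    rw [Real.mul_rpow (by positivity) (by linarith), Real.mul_rpow (by positivity) (by linarith),
      ← mul_sub, ← mul_add, mul_div_mul_left _ _ (by positivity)] at h1
    have t1 := hT u hu2
    have t2 := hT (-u) (by rwa [abs_neg])
    rw [neg_sq] at t2
    have hmax : 1 ≤ (1+-u)^α + (1+u)^α := by
      have p1 : 0 ≤ (1+-u)^α := Real.rpow_nonneg (by linarith) _
      have p2 : 0 ≤ (1+u)^α := Real.rpow_nonneg (by linarith) _
      rcases le_total 0 u with hu0 | hu0
      · linarith [Real.one_le_rpow (by linarith : 1 ≤ 1+u) hα.le]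
      · linarith [Real.one_le_rpow (by linarith : 1 ≤ 1+-u) hα.le]
    set p : ℝ := (1+-u)^α with hp
    set q : ℝ := (1+u)^α with hq
    have h2 : |(p-q)/(p+q) + α*u| ≤ 2*(1+α)*C₁*u^2 := by
      have e : (p-q)/(p+q) + α*u
          = ((p-1-α*(-u)) - (q-1-α*u) + α*u*((p-1-α*(-u)) + (q-1-α*u)))/(p+q) := by
        field_simp; ring
      rw [e, abs_div, abs_of_pos (by linarith : 0 < p+q), div_le_iff₀ (by linarith)]
      have a1 := abs_sub (p-1-α*(-u)) (q-1-α*u)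
      have a2 := abs_add_le (p-1-α*(-u)) (q-1-α*u)
      have a3 : |α*u*((p-1-α*(-u)) + (q-1-α*u))| ≤ α * (2*C₁*u^2) := by
        rw [abs_mul, abs_mul, abs_of_pos hα]
        calc _ ≤ α*1*(2*C₁*u^2) := by
              gcongr
              linarith
          _ = _ := by ring
      have a4 := abs_add_le ((p-1-α*(-u)) - (q-1-α*u)) (α*u*((p-1-α*(-u)) + (q-1-α*u)))
      have a5 : 2*(1+α)*C₁*u^2*1 ≤ 2*(1+α)*C₁*u^2*(p+q) := by gcongr
      linarith
    have h3 := abs_add_le (G - (p-q)/(p+q)) ((p-q)/(p+q) + α*u)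
    rw [← add_assoc, sub_add_cancel] at h3
    have h4 : 0 ≤ (C' + 4*(1+α))*u^2 := by positivity
    have h5 : 0 ≤ (4*(1+α) + 2*(1+α)*C₁)*(1/K) := by positivity
    have h6 : C'/K = C'*(1/K) := by ring
    nlinarith
  · have hu2 : 1/2 ≤ |u| := by rw [habs, le_div_iff₀ hK0]; linarith
    have hu3 : 1/4 ≤ u^2 := by rw [← sq_abs]; nlinarith
    have h1 := abs_add_le G (α*u)
    rw [abs_mul, abs_of_pos hα] at h1
    have h2 : α * |u| ≤ α * 1 := by gcongr
    have h3 : 4*(1+α)*(1/4) ≤ 4*(1+α)*u^2 := by gcongr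
    have h4 : 0 ≤ (C' + 2*(1+α)*C₁)*u^2 := by positivity
    have h5 : 0 ≤ (C' + 4*(1+α) + 2*(1+α)*C₁)*(1/K) := by positivity
    nlinarith

namespace Urn

variable {Ω : Type*} [MeasurableSpace Ω] {μ : Measure Ω} {b r : ℕ → ℝ}

/-- The conditional expectation of the increment of the discrepancy given the past. -/
noncomputable def drift (U : Urn μ b r) (n : ℕ) (ω : Ω) : ℝ :=
  (r (U.Re n ω) - b (U.Bl n ω)) / (r (U.Re n ω) + b (U.Bl n ω))

theorem Bl_add_Re (U : Urn μ b r) (n : ℕ) (ω : Ω) : U.Bl n ω + U.Re n ω = n := by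
  induction n with
  | zero => simp [U.init_Bl, U.init_Re]
  | succ n ih => rcases U.step n ω with h | h <;> omega

theorem abs_D_le (U : Urn μ b r) (n : ℕ) (ω : Ω) : |(U.D n ω : ℝ)| ≤ n := by
  have h := U.Bl_add_Re n ω
  have h' : |U.D n ω| ≤ (n:ℤ) := by rw [D, abs_le]; omega
  exact_mod_cast h'

theorem abs_D_succ_sub (U : Urn μ b r) (n : ℕ) (ω : Ω) :
    |(U.D (n+1) ω : ℝ) - U.D n ω| = 1 := by
  have h' : |U.D (n+1) ω - U.D n ω| = 1 := by
    rcases U.step n ω with h | h <;> simp [D, h]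
  exact_mod_cast h'

theorem abs_D_add_sub_le (U : Urn μ b r) (n k : ℕ) (ω : Ω) :
    |(U.D (n+k) ω : ℝ) - U.D n ω| ≤ k := by
  induction k with
  | zero => simp
  | succ k ih =>
    have h1 := U.abs_D_succ_sub (n+k) ω
    have h2 := abs_add_le ((U.D (n+k+1) ω : ℝ) - U.D (n+k) ω) (U.D (n+k) ω - U.D n ω)
    rw [sub_add_sub_cancel] at h2
    push_cast
    rw [← add_assoc]
    linarith

theorem F_le (U : Urn μ b r) (n : ℕ) : U.F n ≤ ‹MeasurableSpace Ω› :=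
  iSup₂_le fun j _ => ((U.meas_Bl j).prodMk (U.meas_Re j)).comap_le

theorem measurable_F_comp (U : Urn μ b r) {n l : ℕ} (hnl : n ≤ l) (φ : ℕ → ℕ → ℕ → ℕ → ℝ) :
    Measurable[U.F l] fun ω => φ (U.Bl n ω) (U.Re n ω) (U.Bl l ω) (U.Re l ω) := by
  have h : ∀ j, j ≤ l → Measurable[U.F l] fun ω => (U.Bl j ω, U.Re j ω) := fun j hj =>
    Measurable.mono (comap_measurable _) (le_iSup₂_of_le (f := fun j (_ : j ∈ Set.Iic l) =>
      MeasurableSpace.comap (fun ω => (U.Bl j ω, U.Re j ω)) inferInstance) j hj le_rfl) le_rfl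
  exact (Measurable.of_discrete (f := fun p : (ℕ × ℕ) × (ℕ × ℕ) => φ p.1.1 p.1.2 p.2.1 p.2.2)).comp
    ((h n hnl).prodMk (h l le_rfl))

theorem exists_bound_comp (U : Urn μ b r) (n l : ℕ) (φ : ℕ → ℕ → ℕ → ℕ → ℝ) :
    ∃ C, ∀ ω, ‖φ (U.Bl n ω) (U.Re n ω) (U.Bl l ω) (U.Re l ω)‖ ≤ C := by
  refine ⟨∑ p ∈ Finset.range (n+1) ×ˢ Finset.range (l+1),
    ‖φ p.1 (n - p.1) p.2 (l - p.2)‖, fun ω => ?_⟩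
  have h1 := U.Bl_add_Re n ω
  have h2 := U.Bl_add_Re l ω
  have e1 : U.Re n ω = n - U.Bl n ω := by omega
  have e2 : U.Re l ω = l - U.Bl l ω := by omega
  rw [e1, e2]
  have hmem : (U.Bl n ω, U.Bl l ω) ∈ Finset.range (n+1) ×ˢ Finset.range (l+1) := by
    simp only [Finset.mem_product, Finset.mem_range]; omega
  exact Finset.single_le_sum (f := fun p : ℕ × ℕ => ‖φ p.1 (n - p.1) p.2 (l - p.2)‖)
    (fun _ _ => norm_nonneg _) hmem

/-- The pointwise bounds on the drift which drive the moment estimates. -/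
structure DriftBounds (U : Urn μ b r) (α C : ℝ) : Prop where
  pos : 0 < C
  mul_le : ∀ l ω, (U.D l ω : ℝ) * U.drift l ω ≤ C
  abs_add_le : ∀ l ω, |U.drift l ω + α * U.D l ω / ((l:ℝ)+2)|
    ≤ C * (1/((l:ℝ)+2) + (U.D l ω : ℝ)^2/((l:ℝ)+2)^2)

theorem exists_driftBounds (U : Urn μ b r) {α B : ℝ} (hα : 0 < α) {w : ℕ → ℝ}
    (hasymp : WeightAsymp w α B) (hb : ∀ i, 0 < b i) (hr : ∀ i, 0 < r i)
    (hchoice : UrnChoice w b r) : ∃ C, U.DriftBounds α C := by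
  obtain ⟨C, hC, hnb, hnr⟩ := hchoice.exists_isNearPow hasymp
  have hb' : ∀ i, 0 < (2^α * b i)⁻¹ := fun i => by have := hb i; positivity
  have hr' : ∀ i, 0 < (2^α * r i)⁻¹ := fun i => by have := hr i; positivity
  obtain ⟨C₁, hC₁, h₁⟩ := hnb.exists_mul_le hα hC hb' hr' hnr
  obtain ⟨C₂, hC₂, h₂⟩ := hnb.exists_abs_add_le hα hC hb' hr' hnr
  have hdr : ∀ l ω, ((2^α * b (U.Bl l ω))⁻¹ - (2^α * r (U.Re l ω))⁻¹) /
      ((2^α * b (U.Bl l ω))⁻¹ + (2^α * r (U.Re l ω))⁻¹) = U.drift l ω := fun l ω => by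
    have h1 := hb (U.Bl l ω)
    have h2 := hr (U.Re l ω)
    rw [drift]; field_simp
  have hD : ∀ l ω, (U.D l ω : ℝ) = (U.Re l ω : ℝ) - U.Bl l ω := fun l ω => by simp [D]
  refine ⟨C₁ + C₂, by positivity, fun l ω => ?_, fun l ω => ?_⟩
  · have := h₁ (U.Bl l ω) (U.Re l ω)
    rw [hdr, ← hD] at this
    linarith
  · have := h₂ (U.Bl l ω) (U.Re l ω)
    have hl : (l:ℝ) = (U.Bl l ω : ℝ) + U.Re l ω := by exact_mod_cast (U.Bl_add_Re l ω).symm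
    rw [hdr, ← hD, ← hl] at this
    refine this.trans ?_
    gcongr
    linarith

variable [IsProbabilityMeasure μ]

theorem integrable_comp (U : Urn μ b r) {n l : ℕ} (hnl : n ≤ l) (φ : ℕ → ℕ → ℕ → ℕ → ℝ) :
    Integrable (fun ω => φ (U.Bl n ω) (U.Re n ω) (U.Bl l ω) (U.Re l ω)) μ := by
  obtain ⟨C, hC⟩ := U.exists_bound_comp n l φ
  exact Integrable.of_bound
    ((U.measurable_F_comp hnl φ).mono (U.F_le l) le_rfl).aestronglyMeasurable C (.of_forall hC)

theorem integrable_comp_mul_increment (U : Urn μ b r) {n l : ℕ} (hnl : n ≤ l)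
    (φ : ℕ → ℕ → ℕ → ℕ → ℝ) :
    Integrable (fun ω => φ (U.Bl n ω) (U.Re n ω) (U.Bl l ω) (U.Re l ω) *
      ((U.D (l+1) ω : ℝ) - U.D l ω)) μ := by
  refine (U.integrable_comp hnl φ).mul_bdd (c := 1) ?_
    (.of_forall fun ω => (U.abs_D_succ_sub l ω).le)
  exact (U.integrable_comp (Nat.le_succ l)
    (fun a b c d => (((d:ℤ)-c : ℤ) : ℝ) - (((b:ℤ)-a : ℤ) : ℝ))).aestronglyMeasurable

/-- The one-step conditional expectation, integrated against functions of the past. -/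
theorem integral_comp_mul_increment (U : Urn μ b r) (hb : ∀ i, 0 < b i) (hr : ∀ i, 0 < r i)
    {n l : ℕ} (hnl : n ≤ l) (φ : ℕ → ℕ → ℕ → ℕ → ℝ) :
    ∫ ω, φ (U.Bl n ω) (U.Re n ω) (U.Bl l ω) (U.Re l ω) * ((U.D (l+1) ω : ℝ) - U.D l ω) ∂μ =
      ∫ ω, φ (U.Bl n ω) (U.Re n ω) (U.Bl l ω) (U.Re l ω) * U.drift l ω ∂μ := by
  set f : Ω → ℝ := fun ω => φ (U.Bl n ω) (U.Re n ω) (U.Bl l ω) (U.Re l ω) with hf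
  set I : Ω → ℝ := fun ω => if U.Bl (l+1) ω = U.Bl l ω + 1 then (1:ℝ) else 0 with hI
  set p : Ω → ℝ := fun ω => b (U.Bl l ω) / (b (U.Bl l ω) + r (U.Re l ω)) with hp
  have hfi : Integrable f μ := U.integrable_comp hnl φ
  have hIi : Integrable I μ :=
    U.integrable_comp (Nat.le_succ l) (fun a _ c _ => if c = a + 1 then (1:ℝ) else 0)
  have hfI : Integrable (f * I) μ := by
    refine hfi.mul_bdd (c := 1) hIi.aestronglyMeasurable (.of_forall fun ω => ?_)
    by_cases hω : U.Bl (l+1) ω = U.Bl l ω + 1 <;> simp [I, hω]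
  have hfp : Integrable (f * p) μ := U.integrable_comp hnl
    (fun s t c d => φ s t c d * (b c / (b c + r d)))
  have hce : μ[I | U.F l] =ᵐ[μ] p := U.markov l
  have h1 : ∫ ω, (f * I) ω ∂μ = ∫ ω, (f * p) ω ∂μ := by
    rw [← integral_condExp (U.F_le l)]
    refine integral_congr_ae ((condExp_mul_of_stronglyMeasurable_left
      (U.measurable_F_comp hnl φ).stronglyMeasurable hfI hIi).trans ?_)
    exact hce.mono fun ω h => by simp only [Pi.mul_apply, h, hf]
  have hX : ∀ ω, f ω * ((U.D (l+1) ω : ℝ) - U.D l ω) = f ω - 2 * (f * I) ω := by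
    intro ω
    have : (U.D (l+1) ω : ℝ) - U.D l ω = 1 - 2 * I ω := by
      rcases U.step l ω with h | h
      · simp [D, hI, h]; ring
      · simp [D, hI, h]
    rw [this, Pi.mul_apply]; ring
  have hG : ∀ ω, f ω * U.drift l ω = f ω - 2 * (f * p) ω := by
    intro ω
    have : U.drift l ω = 1 - 2 * p ω := by
      have h0 : b (U.Bl l ω) + r (U.Re l ω) ≠ 0 := (add_pos (hb _) (hr _)).ne'
      have h1 : r (U.Re l ω) + b (U.Bl l ω) ≠ 0 := by rwa [add_comm]
      simp only [drift, hp]; field_simp; ring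
    rw [this, Pi.mul_apply]; ring
  rw [integral_congr_ae (.of_forall hX), integral_congr_ae (.of_forall hG), integral_sub hfi (hfI.const_mul 2), integral_sub hfi (hfp.const_mul 2),
    integral_const_mul, integral_const_mul, h1]

theorem memLp_D_sub (U : Urn μ b r) {n l : ℕ} (hnl : n ≤ l) :
    MemLp (fun ω => (U.D l ω : ℝ) - U.D n ω) 2 μ := by
  obtain ⟨C, hC⟩ := U.exists_bound_comp n l
    (fun a b c d => (((d:ℤ)-c : ℤ) : ℝ) - (((b:ℤ)-a : ℤ) : ℝ))
  exact MemLp.of_bound (U.integrable_comp hnl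
    (fun a b c d => (((d:ℤ)-c : ℤ) : ℝ) - (((b:ℤ)-a : ℤ) : ℝ))).aestronglyMeasurable C
    (.of_forall hC)

theorem integrable_drift_comp (U : Urn μ b r) {n l : ℕ} (hnl : n ≤ l) (ψ : ℝ → ℝ → ℝ → ℝ) :
    Integrable (fun ω => ψ (U.D n ω) (U.D l ω) (U.drift l ω)) μ :=
  U.integrable_comp hnl fun s t c d =>
    ψ (((t:ℤ)-s : ℤ) : ℝ) (((d:ℤ)-c : ℤ) : ℝ) ((r d - b c) / (r d + b c))

theorem integrable_mul_increment (U : Urn μ b r) {n l : ℕ} (hnl : n ≤ l) (ψ : ℝ → ℝ → ℝ) :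
    Integrable (fun ω => ψ (U.D n ω) (U.D l ω) * ((U.D (l+1) ω : ℝ) - U.D l ω)) μ :=
  U.integrable_comp_mul_increment hnl fun s t c d => ψ (((t:ℤ)-s : ℤ) : ℝ) (((d:ℤ)-c : ℤ) : ℝ)

theorem integral_mul_increment (U : Urn μ b r) (hb : ∀ i, 0 < b i) (hr : ∀ i, 0 < r i)
    {n l : ℕ} (hnl : n ≤ l) (ψ : ℝ → ℝ → ℝ) :
    ∫ ω, ψ (U.D n ω) (U.D l ω) * ((U.D (l+1) ω : ℝ) - U.D l ω) ∂μ =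
      ∫ ω, ψ (U.D n ω) (U.D l ω) * U.drift l ω ∂μ :=
  U.integral_comp_mul_increment hb hr hnl
    fun s t c d => ψ (((t:ℤ)-s : ℤ) : ℝ) (((d:ℤ)-c : ℤ) : ℝ)

end Urn

namespace Urn

variable {Ω : Type*} [MeasurableSpace Ω] {μ : Measure Ω} [IsProbabilityMeasure μ] {b r : ℕ → ℝ}

theorem integral_D_sq_le (U : Urn μ b r) (hb : ∀ i, 0 < b i) (hr : ∀ i, 0 < r i) {α C : ℝ}
    (h : U.DriftBounds α C) (l : ℕ) : ∫ ω, (U.D l ω : ℝ)^2 ∂μ ≤ (2*C+1)*l := by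
  induction l with
  | zero => simp [D, U.init_Bl, U.init_Re]
  | succ l ih =>
    have hpt : ∀ ω, (U.D (l+1) ω : ℝ)^2 =
        ((U.D l ω : ℝ)^2 + 1) + (2 * U.D l ω) * ((U.D (l+1) ω : ℝ) - U.D l ω) := fun ω => by
      have := sq_abs ((U.D (l+1) ω : ℝ) - U.D l ω)
      rw [U.abs_D_succ_sub] at this
      linear_combination -this
    have i1 : Integrable (fun ω => (U.D l ω : ℝ)^2 + 1) μ :=
      U.integrable_drift_comp le_rfl fun _ y _ => y^2 + 1
    have i2 : Integrable (fun ω => (2 * (U.D l ω : ℝ)) * U.drift l ω) μ :=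
      U.integrable_drift_comp le_rfl fun _ y z => 2 * y * z
    have i0 : Integrable (fun ω => (U.D l ω : ℝ)^2) μ :=
      U.integrable_drift_comp le_rfl fun _ y _ => y^2
    simp_rw [hpt]
    rw [integral_add i1 (U.integrable_mul_increment le_rfl fun _ y => 2 * y),
      U.integral_mul_increment hb hr le_rfl fun _ y => 2 * y, ← integral_add i1 i2]
    have hle : ∫ ω, ((U.D l ω : ℝ)^2 + 1 + 2 * (U.D l ω : ℝ) * U.drift l ω) ∂μ ≤
        ∫ ω, ((U.D l ω : ℝ)^2 + (2*C+1)) ∂μ :=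
      integral_mono (i1.add i2) (i0.add (integrable_const _)) fun ω => by
        have := h.mul_le l ω
        simp only
        linarith
    rw [integral_add i0 (integrable_const _), integral_const] at hle
    simp at hle
    push_cast
    linarith

theorem integral_D_pow_four_le (U : Urn μ b r) (hb : ∀ i, 0 < b i) (hr : ∀ i, 0 < r i) {α C : ℝ}
    (h : U.DriftBounds α C) (l : ℕ) :
    ∫ ω, (U.D l ω : ℝ)^4 ∂μ ≤ (4*C+6)*(2*C+1)*(l:ℝ)^2 := by
  have hC := h.pos
  induction l with
  | zero => simp [D, U.init_Bl, U.init_Re]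
  | succ l ih =>
    have hpt : ∀ ω, (U.D (l+1) ω : ℝ)^4 = ((U.D l ω : ℝ)^4 + 6 * (U.D l ω : ℝ)^2 + 1) +
        (4 * (U.D l ω : ℝ)^3 + 4 * U.D l ω) * ((U.D (l+1) ω : ℝ) - U.D l ω) := fun ω => by
      have := sq_abs ((U.D (l+1) ω : ℝ) - U.D l ω)
      rw [U.abs_D_succ_sub] at this
      generalize (U.D (l+1) ω : ℝ) = y at *
      generalize (U.D l ω : ℝ) = x at *
      obtain ⟨z, rfl⟩ : ∃ z, y = x + z := ⟨y - x, by ring⟩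
      have hz : z^2 = 1 := by rw [add_sub_cancel_left] at this; linarith
      linear_combination (6*x^2+4*x*z+z^2+1)*hz
    have i1 : Integrable (fun ω => (U.D l ω : ℝ)^4 + 6 * (U.D l ω : ℝ)^2 + 1) μ :=
      U.integrable_drift_comp le_rfl fun _ y _ => y^4 + 6*y^2 + 1
    have i2 : Integrable (fun ω => (4 * (U.D l ω : ℝ)^3 + 4 * U.D l ω) * U.drift l ω) μ :=
      U.integrable_drift_comp le_rfl fun _ y z => (4 * y^3 + 4 * y) * z
    have i0 : Integrable (fun ω => (U.D l ω : ℝ)^4) μ :=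
      U.integrable_drift_comp le_rfl fun _ y _ => y^4
    have i3 : Integrable (fun ω => (4*C+6)*(U.D l ω : ℝ)^2) μ :=
      U.integrable_drift_comp le_rfl fun _ y _ => (4*C+6)*y^2
    simp_rw [hpt]
    rw [integral_add i1 (U.integrable_mul_increment le_rfl fun _ y => 4 * y^3 + 4 * y),
      U.integral_mul_increment hb hr le_rfl fun _ y => 4 * y^3 + 4 * y, ← integral_add i1 i2]
    have hle : ∫ ω, ((U.D l ω : ℝ)^4 + 6 * (U.D l ω : ℝ)^2 + 1
          + (4 * (U.D l ω : ℝ)^3 + 4 * U.D l ω) * U.drift l ω) ∂μ ≤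
        ∫ ω, ((U.D l ω : ℝ)^4 + (4*C+6)*(U.D l ω : ℝ)^2 + (4*C+1)) ∂μ :=
      integral_mono (i1.add i2) ((i0.add i3).add (integrable_const _)) fun ω => by
        have := h.mul_le l ω
        have := mul_le_mul_of_nonneg_left this (sq_nonneg (U.D l ω : ℝ))
        simp only
        linarith
    have i03 : Integrable (fun ω => (U.D l ω : ℝ)^4 + (4*C+6)*(U.D l ω : ℝ)^2) μ := i0.add i3
    rw [integral_add i03 (integrable_const _), integral_add i0 i3, integral_const,
      integral_const_mul] at hle
    simp at hle
    have h2 := U.integral_D_sq_le hb hr h l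
    have h3 : (4*C+6)*∫ ω, (U.D l ω : ℝ)^2 ∂μ ≤ (4*C+6)*((2*C+1)*l) := by gcongr
    have h4 : 0 ≤ (4*C+6)*(2*C+1)*l := by positivity
    push_cast
    nlinarith

/-- Moment bounds for the discrepancy, its drift, and the nonlinear part of the drift. -/
structure MomentBounds (U : Urn μ b r) (α A : ℝ) : Prop where
  pos : 0 < A
  D_sq : ∀ l : ℕ, ∫ ω, (U.D l ω : ℝ)^2 ∂μ ≤ A * ((l:ℝ)+2)
  drift_sq : ∀ l : ℕ, ∫ ω, (U.drift l ω)^2 ∂μ ≤ A / ((l:ℝ)+2)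
  abs_error : ∀ l : ℕ, ∫ ω, |U.drift l ω + α * U.D l ω / ((l:ℝ)+2)| ∂μ ≤ A / ((l:ℝ)+2)
  error_sq : ∀ l : ℕ, ∫ ω, (U.drift l ω + α * U.D l ω / ((l:ℝ)+2))^2 ∂μ ≤ A / ((l:ℝ)+2)^2

theorem DriftBounds.exists_momentBounds {U : Urn μ b r} (hb : ∀ i, 0 < b i) (hr : ∀ i, 0 < r i)
    {α C : ℝ} (hα : 0 < α) (h : U.DriftBounds α C) : ∃ A, U.MomentBounds α A := by
  have hC := h.pos
  set A₁ : ℝ := 2*C+1 with hA₁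
  set A₂ : ℝ := 2*((α+C)^2*(2*C+1)+C^2) with hA₂
  set A₃ : ℝ := C*(2*C+2) with hA₃
  set A₄ : ℝ := 2*C^2*(1+(4*C+6)*(2*C+1)) with hA₄
  have hA₁0 : 0 < A₁ := by positivity
  have hA₂0 : 0 < A₂ := by positivity
  have hA₃0 : 0 < A₃ := by positivity
  have hA₄0 : 0 < A₄ := by positivity
  have m2 := U.integral_D_sq_le hb hr h
  have m4 := U.integral_D_pow_four_le hb hr h
  refine ⟨A₁+A₂+A₃+A₄, by positivity, fun l => ?_, fun l => ?_, fun l => ?_, fun l => ?_⟩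
  · refine (m2 l).trans (mul_le_mul ?_ ?_ (by positivity) (by positivity)) <;> linarith
  all_goals
    have hK0 : 0 < (l:ℝ)+2 := by positivity
    have hK1 : 1 ≤ (l:ℝ)+2 := by linarith [Nat.cast_nonneg (α := ℝ) l]
    have hm2 : ∫ ω, (U.D l ω : ℝ)^2 ∂μ ≤ (2*C+1)*((l:ℝ)+2) :=
      (m2 l).trans (by gcongr; linarith)
    have hm4 : ∫ ω, (U.D l ω : ℝ)^4 ∂μ ≤ (4*C+6)*(2*C+1)*((l:ℝ)+2)^2 :=
      (m4 l).trans (by gcongr; linarith)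
    have he := h.abs_add_le l
    have hx : ∀ ω, |(U.D l ω : ℝ)| ≤ (l:ℝ)+2 := fun ω => (U.abs_D_le l ω).trans (by linarith)
    set K : ℝ := (l:ℝ)+2 with hK
    have i2 : Integrable (fun ω => (U.D l ω : ℝ)^2) μ :=
      U.integrable_drift_comp le_rfl fun _ y _ => y^2
    have i4 : Integrable (fun ω => (U.D l ω : ℝ)^4) μ :=
      U.integrable_drift_comp le_rfl fun _ y _ => y^4
  · have hpt : ∀ ω, (U.drift l ω)^2 ≤ 2*(α+C)^2/K^2 * (U.D l ω : ℝ)^2 + 2*C^2/K^2 := by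
      intro ω
      have h1 := he ω
      have h2 := abs_sub (U.drift l ω + α * U.D l ω / K) (α * U.D l ω / K)
      rw [add_sub_cancel_right, abs_div, abs_mul, abs_of_pos hα, abs_of_pos hK0] at h2
      have h3 : (U.D l ω : ℝ)^2/K^2 ≤ |(U.D l ω : ℝ)|/K := by
        rw [div_le_div_iff₀ (by positivity) hK0, ← sq_abs]
        have h5 := mul_le_mul_of_nonneg_left (hx ω)
          (by positivity : 0 ≤ |(U.D l ω : ℝ)| * K)
        nlinarith
      have h4 : |U.drift l ω| ≤ ((α+C)*|(U.D l ω : ℝ)| + C)/K := by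
        have h6 := mul_le_mul_of_nonneg_left h3 hC.le
        have h7 : ((α+C)*|(U.D l ω : ℝ)| + C)/K = α * |(U.D l ω : ℝ)|/K +
          C * (|(U.D l ω : ℝ)|/K) + C*(1/K) := by ring
        linarith
      rw [← sq_abs]
      calc |U.drift l ω|^2 ≤ (((α+C)*|(U.D l ω : ℝ)| + C)/K)^2 := by gcongr
        _ = ((α+C)*|(U.D l ω : ℝ)| + C)^2/K^2 := div_pow _ _ _
        _ ≤ (2*((α+C)*|(U.D l ω : ℝ)|)^2 + 2*C^2)/K^2 := by
            gcongr
            nlinarith [sq_nonneg ((α+C)*|(U.D l ω : ℝ)| - C)]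
        _ = _ := by rw [mul_pow, sq_abs]; ring
    have hle := integral_mono (U.integrable_drift_comp (μ := μ) (le_refl l) fun _ _ z => z^2)
      ((i2.const_mul (2*(α+C)^2/K^2)).add (integrable_const (2*C^2/K^2))) hpt
    simp only [Pi.add_apply] at hle
    rw [integral_add (i2.const_mul _) (integrable_const _), integral_const_mul,
      integral_const] at hle
    simp only [probReal_univ, smul_eq_mul, one_mul] at hle
    refine hle.trans ?_
    calc _ ≤ 2*(α+C)^2/K^2 * ((2*C+1)*K) + 2*C^2/K^2*K := by
          gcongr
          exact le_mul_of_one_le_right (by positivity) hK1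
      _ = A₂/K := by rw [hA₂]; field_simp
      _ ≤ _ := by gcongr; linarith
  · have hle := integral_mono
      (U.integrable_drift_comp (μ := μ) (le_refl l) fun _ y z => |z + α * y / K|)
      ((integrable_const (C*(1/K))).add (i2.const_mul (C/K^2)))
      (fun ω => (he ω).trans (le_of_eq (by simp only [Pi.add_apply]; ring)))
    simp only [Pi.add_apply] at hle
    rw [integral_add (integrable_const _) (i2.const_mul _), integral_const_mul (C/K^2),
      integral_const] at hle
    simp only [probReal_univ, smul_eq_mul, one_mul] at hle
    refine hle.trans ?_
    calc _ ≤ C*(1/K) + C/K^2 * ((2*C+1)*K) := by gcongr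
      _ = A₃/K := by rw [hA₃]; field_simp; ring
      _ ≤ _ := by gcongr; linarith
  · have hpt : ∀ ω, (U.drift l ω + α * U.D l ω / K)^2
        ≤ 2*C^2/K^2 + 2*C^2/K^4 * (U.D l ω : ℝ)^4 := by
      intro ω
      rw [← sq_abs]
      calc _ ≤ (C * (1/K + (U.D l ω : ℝ)^2/K^2))^2 := by gcongr; exact he ω
        _ ≤ C^2*(2*(1/K)^2 + 2*((U.D l ω : ℝ)^2/K^2)^2) := by
            rw [mul_pow]; gcongr
            nlinarith [sq_nonneg (1/K - (U.D l ω : ℝ)^2/K^2)]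
        _ = _ := by ring_nf
    have hle := integral_mono
      (U.integrable_drift_comp (μ := μ) (le_refl l) fun _ y z => (z + α * y / K)^2)
      ((integrable_const (2*C^2/K^2)).add (i4.const_mul (2*C^2/K^4))) hpt
    simp only [Pi.add_apply] at hle
    rw [integral_add (integrable_const _) (i4.const_mul _), integral_const_mul,
      integral_const] at hle
    simp only [probReal_univ, smul_eq_mul, one_mul] at hle
    refine hle.trans ?_
    calc _ ≤ 2*C^2/K^2 + 2*C^2/K^4 * ((4*C+6)*(2*C+1)*K^2) := by gcongr
      _ = A₄/K^2 := by rw [hA₄]; field_simp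
      _ ≤ _ := by gcongr; linarith

theorem integral_D_sub_succ (U : Urn μ b r) (hb : ∀ i, 0 < b i) (hr : ∀ i, 0 < r i) (n k : ℕ) :
    ∫ ω, ((U.D (n+(k+1)) ω : ℝ) - U.D n ω) ∂μ =
      ∫ ω, ((U.D (n+k) ω : ℝ) - U.D n ω) ∂μ + ∫ ω, U.drift (n+k) ω ∂μ := by
  have i1 : Integrable (fun ω => (U.D (n+k) ω : ℝ) - U.D n ω) μ :=
    U.integrable_drift_comp (Nat.le_add_right n k) fun x y _ => y - x
  have i2 := U.integrable_mul_increment (μ := μ) (Nat.le_add_right n k) fun _ _ => 1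
  have e := U.integral_mul_increment (μ := μ) hb hr (Nat.le_add_right n k) fun _ _ => 1
  simp only [one_mul] at e i2
  rw [← e, ← integral_add i1 i2]
  congr 1; ext ω; rw [← add_assoc]; ring

theorem integral_D_sub_mul_succ (U : Urn μ b r) (hb : ∀ i, 0 < b i) (hr : ∀ i, 0 < r i)
    (n k : ℕ) :
    ∫ ω, ((U.D (n+(k+1)) ω : ℝ) - U.D n ω) * U.D n ω ∂μ =
      ∫ ω, ((U.D (n+k) ω : ℝ) - U.D n ω) * U.D n ω ∂μ
        + ∫ ω, U.D n ω * U.drift (n+k) ω ∂μ := by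
  have i1 : Integrable (fun ω => ((U.D (n+k) ω : ℝ) - U.D n ω) * U.D n ω) μ :=
    U.integrable_drift_comp (Nat.le_add_right n k) fun x y _ => (y - x) * x
  have i2 := U.integrable_mul_increment (μ := μ) (Nat.le_add_right n k) fun x _ => x
  have e := U.integral_mul_increment (μ := μ) hb hr (Nat.le_add_right n k) fun x _ => x
  rw [← e, ← integral_add i1 i2]
  congr 1; ext ω; rw [← add_assoc]; ring

theorem integral_D_sub_sq_succ (U : Urn μ b r) (hb : ∀ i, 0 < b i) (hr : ∀ i, 0 < r i)
    (n k : ℕ) :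
    ∫ ω, ((U.D (n+(k+1)) ω : ℝ) - U.D n ω)^2 ∂μ =
      ∫ ω, ((U.D (n+k) ω : ℝ) - U.D n ω)^2 ∂μ + 1
        + 2 * ∫ ω, ((U.D (n+k) ω : ℝ) - U.D n ω) * U.drift (n+k) ω ∂μ := by
  have i1 : Integrable (fun ω => ((U.D (n+k) ω : ℝ) - U.D n ω)^2) μ :=
    U.integrable_drift_comp (Nat.le_add_right n k) fun x y _ => (y - x)^2
  have i2 := U.integrable_mul_increment (μ := μ) (Nat.le_add_right n k) fun x y => y - x
  have e := U.integral_mul_increment (μ := μ) hb hr (Nat.le_add_right n k) fun x y => y - x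
  have e1 : ∫ ω, ((U.D (n+k) ω : ℝ) - U.D n ω)^2 ∂μ + 1 =
      ∫ ω, (((U.D (n+k) ω : ℝ) - U.D n ω)^2 + 1) ∂μ := by
    rw [integral_add i1 (integrable_const _)]; simp
  have i3 : Integrable (fun ω => ((U.D (n+k) ω : ℝ) - U.D n ω)^2 + 1) μ :=
    i1.add (integrable_const 1)
  rw [← e, ← integral_const_mul, e1, ← integral_add i3 (i2.const_mul 2)]
  congr 1; ext ω
  have := sq_abs ((U.D (n+k+1) ω : ℝ) - U.D (n+k) ω)
  rw [U.abs_D_succ_sub] at this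
  rw [← add_assoc]
  linear_combination -this

namespace MomentBounds

variable {U : Urn μ b r} {α A : ℝ}

theorem abs_integral_D_mul_drift_le (h : U.MomentBounds α A) (n k : ℕ) :
    |∫ ω, (U.D n ω : ℝ) * U.drift (n+k) ω ∂μ| ≤ A := by
  have hA := h.pos
  have hK0 : 0 < (n:ℝ)+2 := by positivity
  set K : ℝ := (n:ℝ)+2 with hK
  have i2 : Integrable (fun ω => (U.D n ω : ℝ)^2) μ :=
    U.integrable_drift_comp le_rfl fun _ y _ => y^2
  have ig : Integrable (fun ω => (U.drift (n+k) ω)^2) μ :=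
    U.integrable_drift_comp le_rfl fun _ _ z => z^2
  have hle := integral_mono (U.integrable_drift_comp (μ := μ) (Nat.le_add_right n k)
      fun x _ z => |x * z|) ((i2.const_mul (1/(2*K))).add (ig.const_mul (K/2))) fun ω => by
    simp only [Pi.add_apply]
    rw [abs_mul]
    have e : 1/(2*K) * (U.D n ω : ℝ)^2 + K/2 * (U.drift (n+k) ω)^2
        - |(U.D n ω : ℝ)| * |U.drift (n+k) ω|
        = (|(U.D n ω : ℝ)| - K * |U.drift (n+k) ω|)^2 / (2*K) := by
      rw [← sq_abs (U.D n ω : ℝ), ← sq_abs (U.drift _ _)]; field_simp; ring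
    have : 0 ≤ (|(U.D n ω : ℝ)| - K * |U.drift (n+k) ω|)^2 / (2*K) := by positivity
    linarith
  simp only [Pi.add_apply] at hle
  rw [integral_add (i2.const_mul _) (ig.const_mul _), integral_const_mul,
    integral_const_mul] at hle
  refine (abs_integral_le_integral_abs).trans (hle.trans ?_)
  have h1 := h.D_sq n
  have h2 : ∫ ω, (U.drift (n+k) ω)^2 ∂μ ≤ A / K := (h.drift_sq (n+k)).trans (by
    gcongr; push_cast; linarith [Nat.cast_nonneg (α := ℝ) k])
  calc _ ≤ 1/(2*K) * (A*K) + K/2 * (A/K) := by gcongr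
    _ = A := by field_simp; ring

theorem abs_integral_D_sub_mul_le (h : U.MomentBounds α A) (hb : ∀ i, 0 < b i)
    (hr : ∀ i, 0 < r i) (n k : ℕ) :
    |∫ ω, ((U.D (n+k) ω : ℝ) - U.D n ω) * U.D n ω ∂μ| ≤ A * k := by
  induction k with
  | zero => simp
  | succ k ih =>
    rw [U.integral_D_sub_mul_succ hb hr]
    have := h.abs_integral_D_mul_drift_le n k
    refine (abs_add_le _ _).trans ?_
    push_cast
    linarith

theorem integral_D_sub_mul_drift_eq (U : Urn μ b r) (α : ℝ) (n k : ℕ) :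
    ∫ ω, ((U.D (n+k) ω : ℝ) - U.D n ω) * U.drift (n+k) ω ∂μ =
      -(α/(((n+k : ℕ):ℝ)+2)) * (∫ ω, ((U.D (n+k) ω : ℝ) - U.D n ω)^2 ∂μ +
          ∫ ω, ((U.D (n+k) ω : ℝ) - U.D n ω) * U.D n ω ∂μ) +
        ∫ ω, ((U.D (n+k) ω : ℝ) - U.D n ω) *
          (U.drift (n+k) ω + α * U.D (n+k) ω / (((n+k : ℕ):ℝ)+2)) ∂μ := by
  have hnk := Nat.le_add_right n k
  set K : ℝ := ((n+k : ℕ):ℝ)+2 with hK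
  have i1 : Integrable (fun ω => ((U.D (n+k) ω : ℝ) - U.D n ω)^2) μ :=
    U.integrable_drift_comp hnk fun x y _ => (y - x)^2
  have i2 : Integrable (fun ω => ((U.D (n+k) ω : ℝ) - U.D n ω) * U.D n ω) μ :=
    U.integrable_drift_comp hnk fun x y _ => (y - x) * x
  have i3 : Integrable (fun ω => ((U.D (n+k) ω : ℝ) - U.D n ω) *
      (U.drift (n+k) ω + α * U.D (n+k) ω / K)) μ :=
    U.integrable_drift_comp hnk fun x y z => (y - x) * (z + α * y / K)
  have i4 : Integrable (fun ω => -(α/K) * (((U.D (n+k) ω : ℝ) - U.D n ω)^2 +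
      ((U.D (n+k) ω : ℝ) - U.D n ω) * U.D n ω)) μ := (i1.add i2).const_mul _
  rw [← integral_add i1 i2, ← integral_const_mul, ← integral_add i4 i3]
  congr 1; ext ω; ring

theorem integral_D_sub_sq_le (h : U.MomentBounds α A) (hα : 0 < α) (hb : ∀ i, 0 < b i)
    (hr : ∀ i, 0 < r i) (n k : ℕ) :
    ∫ ω, ((U.D (n+k) ω : ℝ) - U.D n ω)^2 ∂μ ≤ (1 + 2*(α+1)*A) * k := by
  have hA := h.pos
  induction k with
  | zero => simp
  | succ k ih =>
    have hnk := Nat.le_add_right n k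
    have h1 := abs_le.1 (h.abs_integral_D_sub_mul_le hb hr n k)
    have hkK : (k:ℝ) ≤ ((n+k : ℕ):ℝ)+2 := by
      push_cast; linarith [Nat.cast_nonneg (α := ℝ) n]
    have hK0 : 0 < ((n+k : ℕ):ℝ)+2 := by positivity
    have h2 := h.abs_error (n+k)
    rw [U.integral_D_sub_sq_succ hb hr, integral_D_sub_mul_drift_eq U α]
    set K : ℝ := ((n+k : ℕ):ℝ)+2 with hK
    have h3 : ∫ ω, ((U.D (n+k) ω : ℝ) - U.D n ω) *
        (U.drift (n+k) ω + α * U.D (n+k) ω / K) ∂μ ≤ A := by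
      have hle := integral_mono (U.integrable_drift_comp (μ := μ) hnk
          fun x y z => (y - x) * (z + α * y / K))
        ((U.integrable_drift_comp (μ := μ) hnk fun _ y z => |z + α * y / K|).const_mul (k:ℝ))
        fun ω => (le_abs_self _).trans (by
          rw [abs_mul]; gcongr; exact U.abs_D_add_sub_le n k ω)
      rw [integral_const_mul] at hle
      refine hle.trans ?_
      calc _ ≤ (k:ℝ) * (A/K) := by gcongr
        _ ≤ K * (A/K) := by gcongr
        _ = A := by field_simp
    have h4 : -(α/K) * (∫ ω, ((U.D (n+k) ω : ℝ) - U.D n ω)^2 ∂μ +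
        ∫ ω, ((U.D (n+k) ω : ℝ) - U.D n ω) * U.D n ω ∂μ) ≤ α * A := by
      have h5 : 0 ≤ ∫ ω, ((U.D (n+k) ω : ℝ) - U.D n ω)^2 ∂μ :=
        integral_nonneg fun ω => sq_nonneg _
      calc _ ≤ (α/K) * (A * k) := by
            rw [neg_mul, ← mul_neg]; gcongr; linarith
        _ ≤ (α/K) * (A * K) := by gcongr
        _ = _ := by field_simp
    push_cast
    linarith

theorem abs_integral_D_sub_mul_drift_le (h : U.MomentBounds α A) (hα : 0 < α)
    (hb : ∀ i, 0 < b i) (hr : ∀ i, 0 < r i) {n : ℕ} (hn : 0 < n) (k : ℕ) :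
    |∫ ω, ((U.D (n+k) ω : ℝ) - U.D n ω) * U.drift (n+k) ω ∂μ| ≤
      α * ((1 + 2*(α+1)*A) + A) * (k/n) + ((1 + 2*(α+1)*A) + A) / √n := by
  have hA := h.pos
  have hnk := Nat.le_add_right n k
  have h1 := h.abs_integral_D_sub_mul_le hb hr n k
  have h2 := h.integral_D_sub_sq_le hα hb hr n k
  have h3 := h.error_sq (n+k)
  have h5 : 0 ≤ ∫ ω, ((U.D (n+k) ω : ℝ) - U.D n ω)^2 ∂μ := integral_nonneg fun ω => sq_nonneg _
  have hn0 : (0:ℝ) < n := by exact_mod_cast hn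
  have hkK : (k:ℝ) ≤ ((n+k : ℕ):ℝ)+2 := by push_cast; linarith
  have hnK : (n:ℝ) ≤ ((n+k : ℕ):ℝ)+2 := by push_cast; linarith [Nat.cast_nonneg (α := ℝ) k]
  rw [integral_D_sub_mul_drift_eq U α]
  set Q : ℝ := 1 + 2*(α+1)*A with hQ
  have hQ0 : 0 < Q := by positivity
  set K : ℝ := ((n+k : ℕ):ℝ)+2 with hK
  have hK0 : 0 < K := by linarith
  have hs0 : 0 < √K := Real.sqrt_pos.2 hK0
  have hss : √K * √K = K := Real.mul_self_sqrt hK0.le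
  set lam : ℝ := K * √K with hlam
  have hlam0 : 0 < lam := by positivity
  have i1 : Integrable (fun ω => ((U.D (n+k) ω : ℝ) - U.D n ω)^2) μ :=
    U.integrable_drift_comp hnk fun x y _ => (y - x)^2
  have i2 : Integrable (fun ω => (U.drift (n+k) ω + α * U.D (n+k) ω / K)^2) μ :=
    U.integrable_drift_comp hnk fun _ y z => (z + α * y / K)^2
  have h6 : |∫ ω, ((U.D (n+k) ω : ℝ) - U.D n ω) *
      (U.drift (n+k) ω + α * U.D (n+k) ω / K) ∂μ| ≤ (Q + A)/√n := by
    have hle := integral_mono (U.integrable_drift_comp (μ := μ) hnk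
        fun x y z => |(y - x) * (z + α * y / K)|)
      ((i1.const_mul (1/lam)).add (i2.const_mul lam)) fun ω => by
        simp only [Pi.add_apply]
        rw [abs_mul]
        generalize (U.D (n+k) ω : ℝ) - U.D n ω = x
        generalize U.drift (n+k) ω + α * U.D (n+k) ω / K = y
        rw [← sq_abs x, ← sq_abs y]
        have e : 1/lam * |x|^2 + lam * |y|^2 - |x| * |y|
          = ((|x| - lam * |y|)^2 + |x|^2 + (lam * |y|)^2) / (2*lam) := by field_simp; ring
        have : 0 ≤ ((|x| - lam * |y|)^2 + |x|^2 + (lam * |y|)^2) / (2*lam) := by positivity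
        linarith
    simp only [Pi.add_apply] at hle
    rw [integral_add (i1.const_mul _) (i2.const_mul _), integral_const_mul,
      integral_const_mul] at hle
    refine (abs_integral_le_integral_abs).trans (hle.trans ?_)
    calc _ ≤ 1/lam * (Q*K) + lam * (A/K^2) := by gcongr; exact h2.trans (by gcongr)
      _ = Q/√K + A*√K/(√K*√K) := by rw [hss, hlam]; field_simp
      _ = (Q+A)/√K := by field_simp
      _ ≤ _ := by gcongr
  have h7 : |-(α/K) * (∫ ω, ((U.D (n+k) ω : ℝ) - U.D n ω)^2 ∂μ +
      ∫ ω, ((U.D (n+k) ω : ℝ) - U.D n ω) * U.D n ω ∂μ)| ≤ α * (Q + A) * (k/n) := by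
    rw [abs_mul, abs_neg, abs_of_pos (by positivity : 0 < α/K)]
    calc _ ≤ α/K * (Q*k + A*k) := by
          gcongr
          refine (abs_add_le _ _).trans ?_
          rw [abs_of_nonneg h5]
          linarith
      _ ≤ α/n * (Q*k + A*k) := by gcongr
      _ = _ := by ring
  exact (abs_add_le _ _).trans (add_le_add h7 h6)

theorem abs_integral_D_sub_sq_sub_le (h : U.MomentBounds α A) (hα : 0 < α)
    (hb : ∀ i, 0 < b i) (hr : ∀ i, 0 < r i) {n : ℕ} (hn : 0 < n) (k : ℕ) :
    |∫ ω, ((U.D (n+k) ω : ℝ) - U.D n ω)^2 ∂μ - k| ≤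
      k * (2 * (α * ((1 + 2*(α+1)*A) + A) * (k/n) + ((1 + 2*(α+1)*A) + A) / √n)) := by
  have hA := h.pos
  induction k with
  | zero => simp
  | succ k ih =>
    have h1 := h.abs_integral_D_sub_mul_drift_le hα hb hr hn k
    rw [U.integral_D_sub_sq_succ hb hr]
    have h2 := abs_add_le (∫ ω, ((U.D (n+k) ω : ℝ) - U.D n ω)^2 ∂μ - k)
      (2 * ∫ ω, ((U.D (n+k) ω : ℝ) - U.D n ω) * U.drift (n+k) ω ∂μ)
    rw [abs_mul 2, abs_two] at h2
    set R : ℝ := (1 + 2*(α+1)*A) + A with hR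
    have hR0 : 0 < R := by positivity
    have h3 : ((k:ℝ)+1) * (2 * (α * R * (k/n) + R/√n)) ≤
        ((k:ℝ)+1) * (2 * (α * R * (((k:ℝ)+1)/n) + R/√n)) := by
      gcongr; linarith
    push_cast
    rw [show ∀ x y : ℝ, x + 1 + y - ((k:ℝ)+1) = x - k + y by intros; ring]
    linarith

theorem abs_integral_D_sub_le (h : U.MomentBounds α A)
    (hb : ∀ i, 0 < b i) (hr : ∀ i, 0 < r i) {n : ℕ} (hn : 0 < n) (k : ℕ) :
    |∫ ω, ((U.D (n+k) ω : ℝ) - U.D n ω) ∂μ| ≤ k * ((A+1)/√n) := by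
  have hA := h.pos
  induction k with
  | zero => simp
  | succ k ih =>
    have hn0 : (0:ℝ) < n := by exact_mod_cast hn
    have hs0 : 0 < √(n:ℝ) := Real.sqrt_pos.2 hn0
    have hss : √(n:ℝ) * √n = n := Real.mul_self_sqrt hn0.le
    have h1 : ∫ ω, (U.drift (n+k) ω)^2 ∂μ ≤ A / n := (h.drift_sq (n+k)).trans (by
      gcongr; push_cast; linarith [Nat.cast_nonneg (α := ℝ) k])
    have ig : Integrable (fun ω => (U.drift (n+k) ω)^2) μ :=
      U.integrable_drift_comp le_rfl fun _ _ z => z^2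
    have h2 : |∫ ω, U.drift (n+k) ω ∂μ| ≤ (A+1)/√n := by
      have hle := integral_mono (U.integrable_drift_comp (μ := μ) (le_refl (n+k))
          fun _ _ z => |z|) ((ig.const_mul (√(n:ℝ))).add (integrable_const (1/√(n:ℝ)))) fun ω => by
        simp only [Pi.add_apply]
        generalize U.drift (n+k) ω = z
        rw [← sq_abs z]
        have e : √(n:ℝ) * |z|^2 + 1/√(n:ℝ) - |z|
          = ((√(n:ℝ)*|z| - 1)^2 + (√(n:ℝ)*|z|)^2 + 1)/(2*√(n:ℝ)) := by field_simp; ring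
        have : 0 ≤ ((√(n:ℝ)*|z| - 1)^2 + (√(n:ℝ)*|z|)^2 + 1)/(2*√(n:ℝ)) := by positivity
        linarith
      simp only [Pi.add_apply] at hle
      rw [integral_add (ig.const_mul _) (integrable_const _), integral_const_mul,
        integral_const] at hle
      simp only [probReal_univ, smul_eq_mul, one_mul] at hle
      refine (abs_integral_le_integral_abs).trans (hle.trans ?_)
      calc _ ≤ √(n:ℝ) * (A/n) + 1/√n := by gcongr
        _ = √(n:ℝ) * (A/(√n*√n)) + 1/√n := by rw [hss]
        _ = _ := by field_simp
    rw [U.integral_D_sub_succ hb hr]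
    refine (abs_add_le _ _).trans ?_
    push_cast
    linarith

end MomentBounds

end Urn

theorem variance_discrepancy_diff {Ω : Type*} [MeasurableSpace Ω] (μ : MeasureTheory.Measure Ω) [MeasureTheory.IsProbabilityMeasure μ]
    (α B : ℝ) (hα : 0 < α) (w : ℕ → ℝ) (hw : ∀ n, 0 < w n)
    (hasymp : WeightAsymp w α B)
    (b r : ℕ → ℝ) (hb : ∀ i, 0 < b i) (hr : ∀ i, 0 < r i)
    (hchoice : UrnChoice w b r) (U : Urn μ b r) :
    ∃ C₃ > (0:ℝ), ∃ N : ℕ, ∀ n : ℕ, N ≤ n → ∀ m : ℕ, n ≤ m → m ≤ 2*n →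
      |variance (fun ω => (U.D m ω : ℝ) - (U.D n ω : ℝ)) μ - ((m:ℝ) - (n:ℝ))|
        ≤ C₃ * Real.sqrt n * (Real.log n)^2 + C₃ * ((m:ℝ) - (n:ℝ))^2 / (n:ℝ) := by
  obtain ⟨C, hC⟩ := U.exists_driftBounds hα hasymp hb hr hchoice
  obtain ⟨A, hA⟩ := hC.exists_momentBounds hb hr hα
  have hA0 := hA.pos
  set R : ℝ := (1 + 2*(α+1)*A) + A with hR
  have hR0 : 0 < R := by positivity
  refine ⟨2*R + 2*α*R + (A+1)^2, by positivity, 3, fun n hn m hnm hm => ?_⟩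
  obtain ⟨k, rfl⟩ := Nat.exists_eq_add_of_le hnm
  have hn3 : (3:ℝ) ≤ n := by exact_mod_cast hn
  have hn0 : (0:ℝ) < n := by linarith
  have hkn : (k:ℝ) ≤ n := by exact_mod_cast (by omega : k ≤ n)
  have hss : √(n:ℝ) * √n = n := Real.mul_self_sqrt hn0.le
  have hs0 : 0 < √(n:ℝ) := Real.sqrt_pos.2 hn0
  have h1 := hA.abs_integral_D_sub_sq_sub_le hα hb hr (by omega : 0 < n) k
  have h2 := hA.abs_integral_D_sub_le hb hr (by omega : 0 < n) k
  have hlog : 1 ≤ Real.log n := by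
    rw [Real.le_log_iff_exp_le hn0]
    linarith [Real.exp_one_lt_d9]
  have hlog2 : √(n:ℝ) ≤ √n * (Real.log n)^2 :=
    le_mul_of_one_le_right hs0.le (one_le_pow₀ hlog)
  have h3 : (∫ ω, ((U.D (n+k) ω : ℝ) - U.D n ω) ∂μ)^2 ≤ (A+1)^2 * ((k:ℝ)^2/n) := by
    rw [← sq_abs]
    calc _ ≤ (k * ((A+1)/√n))^2 := by gcongr
      _ = (A+1)^2 * ((k:ℝ)^2/(√n*√n)) := by field_simp
      _ = _ := by rw [hss]
  have h4 : (k:ℝ)/√n ≤ √n := by rw [div_le_iff₀ hs0, hss]; exact hkn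
  rw [variance_eq_sub (U.memLp_D_sub (Nat.le_add_right n k))]
  simp only [Pi.pow_apply]
  have e : (((n+k : ℕ):ℝ) - n) = k := by push_cast; ring
  rw [e]
  rw [← hR] at h1
  have h5 : (k:ℝ) * (2 * (α * R * (k/n) + R/√n)) ≤ 2*α*R*((k:ℝ)^2/n) + 2*R*√n := by
    calc _ = 2*α*R*((k:ℝ)^2/n) + 2*R*((k:ℝ)/√n) := by ring
      _ ≤ _ := by gcongr
  have h6 : 0 ≤ (2*α*R + (A+1)^2) * (√n * (Real.log n)^2) := by positivity
  have h7 : 0 ≤ 2*R*((k:ℝ)^2/n) := by positivity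
  have h8 := mul_le_mul_of_nonneg_left hlog2 (by positivity : 0 ≤ 2*R)
  have h9 := sq_nonneg (∫ ω, ((U.D (n+k) ω : ℝ) - U.D n ω) ∂μ)
  have h10 := abs_le.1 h1
  rw [mul_assoc, mul_div_assoc, abs_le]
  constructor <;> linarith
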